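/- For a two-dimensional complex Finsler metric on D, the vv̄-Riemann type tensor satisfies S_{r̄jh̄k} = I·m_h̄·m_r̄·m_j·m_k at every point of D and for all indices r,j,h,k (where m_h̄ denotes the complex conjugate of m_h), and moreover (∂A/∂η̄^s)·m̄^s = −A·B̄ + B/F on D. -/

import Mathlib

open Complex

noncomputable section

namespace CFinsler

/-- A point of `T'M` in local coordinates: `(z, η) ∈ ℂⁿ × ℂⁿ`. -/
abbrev Pt (n : ℕ) := (Fin n → ℂ) × (Fin n → ℂ)

variable {n : ℕ}

/-- Wirtinger derivative `∂f/∂z^k`. -/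
def dz (f : Pt n → ℂ) (k : Fin n) (p : Pt n) : ℂ :=
  (1 / 2) * (fderiv ℝ f p ((Pi.single k 1 : Fin n → ℂ), 0) -
    Complex.I * fderiv ℝ f p ((Pi.single k Complex.I : Fin n → ℂ), 0))

/-- Wirtinger derivative `∂f/∂z̄^k`. -/
def dzbar (f : Pt n → ℂ) (k : Fin n) (p : Pt n) : ℂ :=
  (1 / 2) * (fderiv ℝ f p ((Pi.single k 1 : Fin n → ℂ), 0) +
    Complex.I * fderiv ℝ f p ((Pi.single k Complex.I : Fin n → ℂ), 0))

/-- Wirtinger derivative `∂f/∂η^k`. -/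
def de (f : Pt n → ℂ) (k : Fin n) (p : Pt n) : ℂ :=
  (1 / 2) * (fderiv ℝ f p (0, (Pi.single k 1 : Fin n → ℂ)) -
    Complex.I * fderiv ℝ f p (0, (Pi.single k Complex.I : Fin n → ℂ)))

/-- Wirtinger derivative `∂f/∂η̄^k`. -/
def debar (f : Pt n → ℂ) (k : Fin n) (p : Pt n) : ℂ :=
  (1 / 2) * (fderiv ℝ f p (0, (Pi.single k 1 : Fin n → ℂ)) +
    Complex.I * fderiv ℝ f p (0, (Pi.single k Complex.I : Fin n → ℂ)))

/-- The fundamental metric tensor `g_{i j̄} := ∂²L/∂η^i ∂η̄^j`. -/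
def gm (L : Pt n → ℂ) (i j : Fin n) : Pt n → ℂ := de (debar L j) i

/-- `L` is an `n`-dimensional complex Finsler metric on `D`. -/
structure IsCFM (n : ℕ) (D : Set (Pt n)) (L : Pt n → ℂ) : Prop where
  openD : IsOpen D
  fiber_ne : ∀ p ∈ D, p.2 ≠ 0
  conic : ∀ p ∈ D, ∀ lam : ℂ, lam ≠ 0 → (p.1, lam • p.2) ∈ D
  smooth : ContDiffOn ℝ (⊤ : ℕ∞) L D
  real_im : ∀ p ∈ D, (L p).im = 0
  pos : ∀ p ∈ D, 0 < (L p).re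
  homog : ∀ p ∈ D, ∀ lam : ℂ, lam ≠ 0 →
    L (p.1, lam • p.2) = ((Complex.normSq lam : ℝ) : ℂ) * L p
  hermitian : ∀ p ∈ D, ∀ i j, (starRingEnd ℂ) (gm L i j p) = gm L j i p
  posdef : ∀ p ∈ D, ∀ v : Fin n → ℂ, v ≠ 0 →
    0 < (∑ i, ∑ j, gm L i j p * v i * (starRingEnd ℂ) (v j)).re

variable (L : Pt n → ℂ)

/-- The metric tensor as a matrix at a point. -/
def gmat (p : Pt n) : Matrix (Fin n) (Fin n) ℂ := fun i j => gm L i j p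

/-- The inverse metric tensor `g^{l̄ i}`. -/
def gi (l i : Fin n) (p : Pt n) : ℂ := (gmat L p)⁻¹ l i

/-- The Chern–Finsler nonlinear connection coefficients
`N^i_k := g^{m̄ i} (∂g_{l m̄}/∂z^k) η^l`. -/
def Nc (i k : Fin n) (p : Pt n) : ℂ :=
  ∑ m, ∑ l, gi L m i p * dz (gm L l m) k p * p.2 l

/-- The horizontal derivation `δ_k := ∂/∂z^k − N^j_k ∂/∂η^j`. -/
def del (f : Pt n → ℂ) (k : Fin n) (p : Pt n) : ℂ :=
  dz f k p - ∑ j, Nc L j k p * de f j p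

/-- The conjugate horizontal derivation `δ_k̄ := ∂/∂z̄^k − N̄^j_k ∂/∂η̄^j`. -/
def delbar (f : Pt n → ℂ) (k : Fin n) (p : Pt n) : ℂ :=
  dzbar f k p - ∑ j, (starRingEnd ℂ) (Nc L j k p) * debar f j p

/-- The horizontal Chern–Finsler connection coefficients `L^i_{jk} := g^{l̄ i} δ_k(g_{j l̄})`. -/
def Lc (i j k : Fin n) (p : Pt n) : ℂ := ∑ l, gi L l i p * del L (gm L j l) k p

/-- The vertical Chern–Finsler connection coefficients `C^i_{jk} := g^{l̄ i} ∂g_{j l̄}/∂η^k`. -/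
def Cc (i j k : Fin n) (p : Pt n) : ℂ := ∑ l, gi L l i p * de (gm L j l) k p

/-- The spray coefficients `G^i := ½ N^i_j η^j`. -/
def Gs (i : Fin n) (p : Pt n) : ℂ := (1 / 2) * ∑ j, Nc L i j p * p.2 j

/-- The canonical horizontal derivation `δ̊_k := ∂/∂z^k − (∂G^j/∂η^k) ∂/∂η^j`. -/
def delc (f : Pt n → ℂ) (k : Fin n) (p : Pt n) : ℂ :=
  dz f k p - ∑ j, de (Gs L j) k p * de f j p

/-- `F := √L`. -/
def Fh (p : Pt n) : ℂ := (Real.sqrt ((L p).re) : ℂ)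

/-- `l^i := η^i / F`. -/
def lup (i : Fin n) (p : Pt n) : ℂ := p.2 i / Fh L p

/-- `l_i := g_{i j̄} η̄^j / F`. -/
def llow (i : Fin n) (p : Pt n) : ℂ :=
  (∑ j, gm L i j p * (starRingEnd ℂ) (p.2 j)) / Fh L p

/-- `√g` where `g := det(g_{i j̄})`. -/
def sg (p : Pt n) : ℂ := (Real.sqrt ((gmat L p).det.re) : ℂ)

/-- The metric is Kähler. -/
def IsKahler (D : Set (Pt n)) : Prop := ∀ p ∈ D, ∀ i j k, Lc L i j k p = Lc L i k j p

/-- The metric is weakly Kähler. -/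
def IsWeaklyKahler (D : Set (Pt n)) : Prop :=
  ∀ p ∈ D, ∀ k, (∑ i, ∑ j, ∑ l, gm L i l p * (Lc L i j k p - Lc L i k j p) *
    p.2 j * (starRingEnd ℂ) (p.2 l)) = 0

/-- The metric is purely Hermitian: `g_{i j̄}` does not depend on the fibre variable. -/
def IsPurelyHermitian (D : Set (Pt n)) : Prop :=
  ∀ p ∈ D, ∀ i j k, de (gm L i j) k p = 0 ∧ debar (gm L i j) k p = 0

/-- The metric is a complex Berwald metric: Kähler with `L^i_{jk}` independent of the
fibre variable. -/
def IsBerwald (D : Set (Pt n)) : Prop :=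
  IsKahler L D ∧ ∀ p ∈ D, ∀ i j k l, de (Lc L i j k) l p = 0 ∧ debar (Lc L i j k) l p = 0

/-- The metric is a complex Landsberg metric: the Berwald and Rund connections coincide. -/
def IsLandsberg (D : Set (Pt n)) : Prop :=
  ∀ p ∈ D, ∀ i j k, de (de (Gs L i) k) j p =
    (1 / 2) * ∑ l, gi L l i p * (delc L (gm L j l) k p + delc L (gm L k l) j p)

/-- `m^i` of the local complex Berwald frame: `m¹ = −l₂/√g`, `m² = l₁/√g`. -/
def mup (L : Pt 2 → ℂ) (i : Fin 2) (p : Pt 2) : ℂ :=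
  if i = 0 then -(llow L 1 p) / sg L p else llow L 0 p / sg L p

/-- `m_i := g_{i j̄} m̄^j`. -/
def mlow (L : Pt 2 → ℂ) (i : Fin 2) (p : Pt 2) : ℂ :=
  ∑ j, gm L i j p * (starRingEnd ℂ) (mup L j p)

/-- `A := m^j m^k l_h C^h_{kj}`. -/
def sA (L : Pt 2 → ℂ) (p : Pt 2) : ℂ :=
  ∑ j, ∑ k, ∑ h, mup L j p * mup L k p * llow L h p * Cc L h k j p

/-- `B := m_h m^k m^j C^h_{jk}`. -/
def sB (L : Pt 2 → ℂ) (p : Pt 2) : ℂ :=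
  ∑ j, ∑ k, ∑ h, mlow L h p * mup L k p * mup L j p * Cc L h j k p

/-- `J := l^j l^k l_i L^i_{jk}`. -/
def sJ (L : Pt 2 → ℂ) (p : Pt 2) : ℂ :=
  ∑ j, ∑ k, ∑ i, lup L j p * lup L k p * llow L i p * Lc L i j k p

/-- `U := m^j l^k l_i L^i_{jk}`. -/
def sU (L : Pt 2 → ℂ) (p : Pt 2) : ℂ :=
  ∑ j, ∑ k, ∑ i, mup L j p * lup L k p * llow L i p * Lc L i j k p

/-- `V := l^j m^k l_i L^i_{jk}`. -/
def sV (L : Pt 2 → ℂ) (p : Pt 2) : ℂ :=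
  ∑ j, ∑ k, ∑ i, lup L j p * mup L k p * llow L i p * Lc L i j k p

/-- `X := m^j m^k l_i L^i_{jk}`. -/
def sX (L : Pt 2 → ℂ) (p : Pt 2) : ℂ :=
  ∑ j, ∑ k, ∑ i, mup L j p * mup L k p * llow L i p * Lc L i j k p

/-- `O := l^j l^k m_i L^i_{jk}`. -/
def sO (L : Pt 2 → ℂ) (p : Pt 2) : ℂ :=
  ∑ j, ∑ k, ∑ i, lup L j p * lup L k p * mlow L i p * Lc L i j k p

/-- `Y := m^j l^k m_i L^i_{jk}`. -/
def sY (L : Pt 2 → ℂ) (p : Pt 2) : ℂ :=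
  ∑ j, ∑ k, ∑ i, mup L j p * lup L k p * mlow L i p * Lc L i j k p

/-- `E := l^j m^k m_i L^i_{jk}`. -/
def sE (L : Pt 2 → ℂ) (p : Pt 2) : ℂ :=
  ∑ j, ∑ k, ∑ i, lup L j p * mup L k p * mlow L i p * Lc L i j k p

/-- `H := m^j m^k m_i L^i_{jk}`. -/
def sH (L : Pt 2 → ℂ) (p : Pt 2) : ℂ :=
  ∑ j, ∑ k, ∑ i, mup L j p * mup L k p * mlow L i p * Lc L i j k p

/-- The vertical curvature invariant `I := −(∂B/∂η̄^s) m̄^s − B B̄/2`. -/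
def vI (L : Pt 2 → ℂ) (p : Pt 2) : ℂ :=
  -(∑ s, debar (sB L) s p * (starRingEnd ℂ) (mup L s p)) -
    sB L p * (starRingEnd ℂ) (sB L p) / 2

/-- The `v v̄`-Riemann type tensor `S_{r̄ j h̄ k} := −g_{i r̄} ∂C^i_{jk}/∂η̄^h`. -/
def Sv (L : Pt 2 → ℂ) (r j h k : Fin 2) (p : Pt 2) : ℂ :=
  -∑ i, gm L i r p * debar (Cc L i j k) h p

/-- The `h h̄`-Riemann type tensor
`R_{r̄ j h̄ k} := g_{i r̄} (−δ_h̄(L^i_{jk}) − δ_h̄(N^l_k) C^i_{jl})`. -/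
def Rh (L : Pt 2 → ℂ) (r j h k : Fin 2) (p : Pt 2) : ℂ :=
  ∑ i, gm L i r p *
    (-(delbar L (Lc L i j k) h p) - ∑ l, delbar L (Nc L l k) h p * Cc L i j l p)

/-- The horizontal curvature invariant `K := −(1/F) δ_k̄(J) η̄^k`. -/
def hK (L : Pt 2 → ℂ) (p : Pt 2) : ℂ :=
  -(1 / Fh L p) * ∑ k, delbar L (sJ L) k p * (starRingEnd ℂ) (p.2 k)

/-- The horizontal curvature invariant
`W := −δ_s̄(H) m̄^s − ½ H (V̄+H̄) − B F δ_s̄(E) m̄^s`. -/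
def hW (L : Pt 2 → ℂ) (p : Pt 2) : ℂ :=
  -(∑ s, delbar L (sH L) s p * (starRingEnd ℂ) (mup L s p)) -
    (1 / 2) * sH L p * ((starRingEnd ℂ) (sV L p) + (starRingEnd ℂ) (sH L p)) -
    sB L p * Fh L p * ∑ s, delbar L (sE L) s p * (starRingEnd ℂ) (mup L s p)

/-- The weak symmetry condition `R_{0̄ k 0̄ 0} = R_{0̄ 0 0̄ k}`, i.e.
`R_{r̄ k h̄ s} η̄^r η̄^h η^s = R_{r̄ s h̄ k} η̄^r η^s η̄^h`. -/
def WeakSym (L : Pt 2 → ℂ) (D : Set (Pt 2)) : Prop :=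
  ∀ p ∈ D, ∀ k,
    (∑ r, ∑ h, ∑ s, Rh L r k h s p * (starRingEnd ℂ) (p.2 r) *
      (starRingEnd ℂ) (p.2 h) * p.2 s) =
    ∑ r, ∑ s, ∑ h, Rh L r s h k p * (starRingEnd ℂ) (p.2 r) * p.2 s *
      (starRingEnd ℂ) (p.2 h)


open scoped ContDiff

section Wirtinger

/-- A first-order constant-coefficient operator `½ (∂_a + c ∂_b)`. -/
def wirt (c : ℂ) (a b : Pt n) (f : Pt n → ℂ) (p : Pt n) : ℂ :=
  (1 / 2) * (fderiv ℝ f p a + c * fderiv ℝ f p b)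

lemma de_eq_wirt (f : Pt n → ℂ) (k : Fin n) :
    de f k = wirt (-I) (0, Pi.single k 1) (0, Pi.single k I) f := by
  funext p; simp only [de, wirt]; ring

lemma debar_eq_wirt (f : Pt n → ℂ) (k : Fin n) :
    debar f k = wirt I (0, Pi.single k 1) (0, Pi.single k I) f := rfl

variable {c c' : ℂ} {a b a' b' : Pt n} {f g : Pt n → ℂ} {p : Pt n} {D : Set (Pt n)}

lemma wirt_congr (h : f =ᶠ[nhds p] g) : wirt c a b f p = wirt c a b g p := by
  simp only [wirt, h.fderiv_eq]

lemma wirt_congr_on (hD : IsOpen D) (hp : p ∈ D) (h : ∀ q ∈ D, f q = g q) :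
    wirt c a b f p = wirt c a b g p :=
  wirt_congr (Filter.eventually_of_mem (hD.mem_nhds hp) h)

lemma wirt_mul (hf : DifferentiableAt ℝ f p) (hg : DifferentiableAt ℝ g p) :
    wirt c a b (fun q => f q * g q) p = wirt c a b f p * g p + f p * wirt c a b g p := by
  simp only [wirt, fderiv_fun_mul hf hg]
  simp only [add_apply, smul_apply, smul_eq_mul]
  ring

lemma wirt_sum {ι : Type*} (s : Finset ι) {F : ι → Pt n → ℂ}
    (hF : ∀ i ∈ s, DifferentiableAt ℝ (F i) p) :
    wirt c a b (fun q => ∑ i ∈ s, F i q) p = ∑ i ∈ s, wirt c a b (F i) p := by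
  simp only [wirt, fderiv_fun_sum hF]
  simp only [sum_apply, Finset.mul_sum, ← Finset.sum_add_distrib, mul_add]

lemma contDiffOn_fderiv_apply (hD : IsOpen D) (hf : ContDiffOn ℝ ∞ f D) (v : Pt n) :
    ContDiffOn ℝ ∞ (fun q => fderiv ℝ f q v) D :=
  (hf.fderiv_of_isOpen hD (by simp)).clm_apply contDiffOn_const

lemma contDiffOn_wirt (hD : IsOpen D) (hf : ContDiffOn ℝ ∞ f D) :
    ContDiffOn ℝ ∞ (wirt c a b f) D :=
  contDiffOn_const.mul ((contDiffOn_fderiv_apply hD hf a).add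
    (contDiffOn_const.mul (contDiffOn_fderiv_apply hD hf b)))

lemma differentiableAt_of_contDiffOn (hD : IsOpen D) (hf : ContDiffOn ℝ ∞ f D) (hp : p ∈ D) :
    DifferentiableAt ℝ f p :=
  (hf.contDiffAt (hD.mem_nhds hp)).differentiableAt (by simp)

lemma fderiv_wirt (hD : IsOpen D) (hf : ContDiffOn ℝ ∞ f D) (hp : p ∈ D) (v : Pt n) :
    fderiv ℝ (wirt c a b f) p v =
      (1 / 2) * (fderiv ℝ (fderiv ℝ f) p v a + c * fderiv ℝ (fderiv ℝ f) p v b) := by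
  have h : DifferentiableAt ℝ (fderiv ℝ f) p :=
    ((hf.fderiv_of_isOpen (m := ∞) hD (by simp)).contDiffAt
      (hD.mem_nhds hp)).differentiableAt (by simp)
  have h1 (w : Pt n) : HasFDerivAt (fun q => fderiv ℝ f q w)
      ((fderiv ℝ (fderiv ℝ f) p).flip w) p := by
    simpa using h.hasFDerivAt.clm_apply (hasFDerivAt_const w p)
  have h2 : HasFDerivAt (wirt c a b f) _ p :=
    ((h1 a).add ((h1 b).const_mul c)).const_mul (1 / 2 : ℂ)
  rw [h2.fderiv]
  simp
  ring

lemma wirt_comm (hD : IsOpen D) (hf : ContDiffOn ℝ ∞ f D) (hp : p ∈ D) :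
    wirt c a b (wirt c' a' b' f) p = wirt c' a' b' (wirt c a b f) p := by
  have hs : IsSymmSndFDerivAt ℝ f p :=
    (hf.contDiffAt (hD.mem_nhds hp)).isSymmSndFDerivAt
      (by simpa using (WithTop.coe_le_coe.2 (le_top : (2 : ℕ∞) ≤ ⊤)))
  rw [wirt, wirt, fderiv_wirt hD hf hp, fderiv_wirt hD hf hp, fderiv_wirt hD hf hp,
    fderiv_wirt hD hf hp, hs.eq a a', hs.eq a b', hs.eq b a', hs.eq b b']
  ring

lemma de_congr_on (hD : IsOpen D) (hp : p ∈ D) (h : ∀ q ∈ D, f q = g q) (k : Fin n) :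
    de f k p = de g k p := by
  simpa only [de_eq_wirt] using wirt_congr_on hD hp h

lemma debar_congr_on (hD : IsOpen D) (hp : p ∈ D) (h : ∀ q ∈ D, f q = g q) (k : Fin n) :
    debar f k p = debar g k p := wirt_congr_on hD hp h

lemma de_mul (hf : DifferentiableAt ℝ f p) (hg : DifferentiableAt ℝ g p) (k : Fin n) :
    de (fun q => f q * g q) k p = de f k p * g p + f p * de g k p := by
  simpa only [de_eq_wirt] using wirt_mul hf hg

lemma debar_mul (hf : DifferentiableAt ℝ f p) (hg : DifferentiableAt ℝ g p) (k : Fin n) :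
    debar (fun q => f q * g q) k p = debar f k p * g p + f p * debar g k p := wirt_mul hf hg

lemma de_sum {ι : Type*} (s : Finset ι) {F : ι → Pt n → ℂ}
    (hF : ∀ i ∈ s, DifferentiableAt ℝ (F i) p) (k : Fin n) :
    de (fun q => ∑ i ∈ s, F i q) k p = ∑ i ∈ s, de (F i) k p := by
  simpa only [de_eq_wirt] using wirt_sum s hF

lemma debar_sum {ι : Type*} (s : Finset ι) {F : ι → Pt n → ℂ}
    (hF : ∀ i ∈ s, DifferentiableAt ℝ (F i) p) (k : Fin n) :
    debar (fun q => ∑ i ∈ s, F i q) k p = ∑ i ∈ s, debar (F i) k p := wirt_sum s hF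

lemma contDiffOn_de (hD : IsOpen D) (hf : ContDiffOn ℝ ∞ f D) (k : Fin n) :
    ContDiffOn ℝ ∞ (de f k) D := by
  simpa only [de_eq_wirt] using contDiffOn_wirt hD hf

lemma contDiffOn_debar (hD : IsOpen D) (hf : ContDiffOn ℝ ∞ f D) (k : Fin n) :
    ContDiffOn ℝ ∞ (debar f k) D := contDiffOn_wirt hD hf

lemma de_de_comm (hD : IsOpen D) (hf : ContDiffOn ℝ ∞ f D) (hp : p ∈ D) (i j : Fin n) :
    de (de f i) j p = de (de f j) i p := by
  simpa only [de_eq_wirt] using wirt_comm hD hf hp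

lemma debar_de_comm (hD : IsOpen D) (hf : ContDiffOn ℝ ∞ f D) (hp : p ∈ D) (i j : Fin n) :
    debar (de f i) j p = de (debar f j) i p := by
  simpa only [de_eq_wirt, debar_eq_wirt] using wirt_comm hD hf hp

lemma debar_debar_comm (hD : IsOpen D) (hf : ContDiffOn ℝ ∞ f D) (hp : p ∈ D) (i j : Fin n) :
    debar (debar f i) j p = debar (debar f j) i p := wirt_comm hD hf hp

lemma hasFDerivAt_fiber (i : Fin n) (p : Pt n) :
    HasFDerivAt (fun q : Pt n => q.2 i)
      ((ContinuousLinearMap.proj (R := ℝ) (φ := fun _ : Fin n => ℂ) i).comp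
        (ContinuousLinearMap.snd ℝ (Fin n → ℂ) (Fin n → ℂ))) p :=
  ContinuousLinearMap.hasFDerivAt (f := (ContinuousLinearMap.proj (R := ℝ)
    (φ := fun _ : Fin n => ℂ) i).comp (ContinuousLinearMap.snd ℝ (Fin n → ℂ) (Fin n → ℂ)))

lemma de_fiber (i k : Fin n) (p : Pt n) :
    de (fun q : Pt n => q.2 i) k p = if i = k then 1 else 0 := by
  simp only [de, (hasFDerivAt_fiber i p).fderiv]
  by_cases h : i = k <;> simp [h]
  norm_num

lemma debar_fiber (i k : Fin n) (p : Pt n) : debar (fun q : Pt n => q.2 i) k p = 0 := by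
  simp only [debar, (hasFDerivAt_fiber i p).fderiv]
  by_cases h : i = k <;> simp [h]

lemma debar_conj (hf : DifferentiableAt ℝ f p) (k : Fin n) :
    debar (fun q => (starRingEnd ℂ) (f q)) k p = (starRingEnd ℂ) (de f k p) := by
  have h := (conjCLE.toContinuousLinearMap.hasFDerivAt (x := f p)).comp p hf.hasFDerivAt
  have h' : fderiv ℝ (fun q => (starRingEnd ℂ) (f q)) p = _ := h.fderiv
  have h2 : (starRingEnd ℂ) 2 = 2 := map_ofNat _ 2
  simp [de, debar, h', h2]

lemma contDiffOn_fiber (i : Fin n) : ContDiffOn ℝ ∞ (fun q : Pt n => q.2 i) D :=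
  (contDiff_apply ℝ ℂ i).comp_contDiffOn contDiffOn_snd

lemma contDiffOn_conj (hf : ContDiffOn ℝ ∞ f D) :
    ContDiffOn ℝ ∞ (fun q => (starRingEnd ℂ) (f q)) D :=
  conjCLE.toContinuousLinearMap.contDiff.comp_contDiffOn hf

lemma contDiffOn_conj_fiber (j : Fin n) :
    ContDiffOn ℝ ∞ (fun q : Pt n => (starRingEnd ℂ) (q.2 j)) D :=
  contDiffOn_conj (contDiffOn_fiber j)

lemma de_conj_fiber (i k : Fin n) (p : Pt n) :
    de (fun q : Pt n => (starRingEnd ℂ) (q.2 i)) k p = 0 := by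
  have h := (conjCLE.toContinuousLinearMap.hasFDerivAt (x := p.2 i)).comp p (hasFDerivAt_fiber i p)
  have h' : fderiv ℝ (fun q : Pt n => (starRingEnd ℂ) (q.2 i)) p = _ := h.fderiv
  simp only [de, h']
  by_cases h : i = k <;> simp [h]

lemma snd_eq_sum (v : Fin n → ℂ) :
    ((0, v) : Pt n) = ∑ k, ((v k).re • ((0, Pi.single k 1) : Pt n) +
      (v k).im • ((0, Pi.single k I) : Pt n)) := by
  refine Prod.ext ?_ ?_
  · simp [Prod.fst_sum]
  · funext j
    simp only [Prod.snd_sum, Finset.sum_apply, Prod.snd_add, Prod.smul_snd, Pi.add_apply,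
      Pi.smul_apply, Pi.single_apply, smul_ite, smul_zero, Finset.sum_add_distrib,
      Finset.sum_ite_eq, Finset.mem_univ, if_true, real_smul, mul_one, re_add_im]

lemma fderiv_fiber_eq (f : Pt n → ℂ) (p : Pt n) (v : Fin n → ℂ) :
    fderiv ℝ f p (0, v) = ∑ k, (de f k p * v k + debar f k p * (starRingEnd ℂ) (v k)) := by
  rw [snd_eq_sum v, map_sum]
  refine Finset.sum_congr rfl fun k _ => ?_
  rw [map_add, map_smul, map_smul]
  simp only [de, debar, real_smul]
  conv_rhs => rw [← re_add_im (v k)]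
  simp only [map_add, map_mul, conj_ofReal, conj_I]
  linear_combination ((v k).im * fderiv ℝ f p (0, Pi.single k I)) * I_sq

end Wirtinger

section Metric

variable {D : Set (Pt n)} {L : Pt n → ℂ}

namespace IsCFM

lemma fderiv_line (hL : IsCFM n D L) {p : Pt n} (hp : p ∈ D) (c : ℂ) :
    fderiv ℝ L p (0, c • p.2) = 2 * c.re * L p := by
  have hγ : HasDerivAt (fun t : ℝ => (p.1, (1 + t * c) • p.2)) ((0, c • p.2) : Pt n) 0 := by
    refine (hasDerivAt_const _ _).prodMk ?_
    have h : HasDerivAt (fun t : ℝ => 1 + (t : ℂ) * c) c 0 := by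
      simpa using (((hasDerivAt_id (0 : ℝ)).ofReal_comp).mul_const c).const_add 1
    exact h.smul_const p.2
  have hd : HasFDerivAt L (fderiv ℝ L p) ((fun t : ℝ => (p.1, (1 + t * c) • p.2)) 0) := by
    simpa using (differentiableAt_of_contDiffOn hL.openD hL.smooth hp).hasFDerivAt
  have h1 := hd.comp_hasDerivAt (0 : ℝ) hγ
  have h2 : HasDerivAt (fun t : ℝ => ((normSq (1 + t * c) : ℝ) : ℂ) * L p)
      (2 * c.re * L p) 0 := by
    have h : HasDerivAt (fun t : ℝ => normSq (1 + t * c)) (2 * c.re) 0 := by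
      have e : (fun t : ℝ => normSq (1 + t * c)) =
          fun t => (1 + t * c.re) * (1 + t * c.re) + (t * c.im) * (t * c.im) := by
        funext t; simp [normSq_apply]
      have i1 : HasDerivAt (fun t : ℝ => 1 + t * c.re) c.re 0 := by
        simpa using ((hasDerivAt_id (0 : ℝ)).mul_const c.re).const_add 1
      have i2 : HasDerivAt (fun t : ℝ => t * c.im) c.im 0 := by
        simpa using (hasDerivAt_id (0 : ℝ)).mul_const c.im
      rw [e]
      exact ((i1.fun_mul i1).fun_add (i2.fun_mul i2)).congr_deriv (by ring)
    simpa using h.ofReal_comp.mul_const (L p)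
  refine h1.unique (h2.congr_of_eventuallyEq ?_)
  have hc : ContinuousAt (fun t : ℝ => 1 + (t : ℂ) * c) 0 := by fun_prop
  filter_upwards [hc.eventually_ne (y := 0) (by simp)] with t ht
  exact hL.homog p hp _ ht

lemma euler_de (hL : IsCFM n D L) {p : Pt n} (hp : p ∈ D) : ∑ i, de L i p * p.2 i = L p := by
  have h1 := hL.fderiv_line hp 1
  have h2 := hL.fderiv_line hp I
  rw [fderiv_fiber_eq, Finset.sum_add_distrib] at h1 h2
  simp only [Pi.smul_apply, smul_eq_mul, map_mul, conj_I, mul_left_comm _ I,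
    mul_left_comm _ (-I), ← Finset.mul_sum, one_mul, one_re, I_re] at h1 h2
  push_cast at h1 h2
  linear_combination (1 / 2) * h1 - (I / 2) * h2 +
    (1 / 2) * (∑ i, de L i p * p.2 i - ∑ i, debar L i p * (starRingEnd ℂ) (p.2 i)) * I_sq

lemma euler_debar (hL : IsCFM n D L) {p : Pt n} (hp : p ∈ D) :
    ∑ i, debar L i p * (starRingEnd ℂ) (p.2 i) = L p := by
  have h1 := hL.fderiv_line hp 1
  rw [fderiv_fiber_eq, Finset.sum_add_distrib] at h1
  simp only [Pi.smul_apply, smul_eq_mul, one_mul, one_re, hL.euler_de hp] at h1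
  push_cast at h1
  linear_combination h1

lemma contDiffOn_gm (hL : IsCFM n D L) (i j : Fin n) : ContDiffOn ℝ ∞ (gm L i j) D :=
  contDiffOn_de hL.openD (contDiffOn_debar hL.openD hL.smooth j) i

lemma debar_de (hL : IsCFM n D L) {p : Pt n} (hp : p ∈ D) (i j : Fin n) :
    debar (de L i) j p = gm L i j p :=
  debar_de_comm hL.openD hL.smooth hp i j

lemma debar_gm_comm (hL : IsCFM n D L) {p : Pt n} (hp : p ∈ D) (i j h : Fin n) :
    debar (gm L i j) h p = debar (gm L i h) j p := by
  rw [gm, gm, debar_de_comm hL.openD (contDiffOn_debar hL.openD hL.smooth _) hp,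
    debar_de_comm hL.openD (contDiffOn_debar hL.openD hL.smooth _) hp]
  exact de_congr_on hL.openD hp (fun q hq => debar_debar_comm hL.openD hL.smooth hq j h) i

lemma de_gm_comm (hL : IsCFM n D L) {p : Pt n} (hp : p ∈ D) (i j k : Fin n) :
    de (gm L i j) k p = de (gm L k j) i p :=
  de_de_comm hL.openD (contDiffOn_debar hL.openD hL.smooth j) hp i k

lemma debar_gm (hL : IsCFM n D L) {p : Pt n} (hp : p ∈ D) (i j h : Fin n) :
    debar (gm L i j) h p = (starRingEnd ℂ) (de (gm L j i) h p) := by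
  rw [← debar_conj (differentiableAt_of_contDiffOn hL.openD (hL.contDiffOn_gm j i) hp)]
  exact debar_congr_on hL.openD hp (fun q hq => (hL.hermitian q hq j i).symm) h

lemma sum_gm_fiber (hL : IsCFM n D L) {p : Pt n} (hp : p ∈ D) (h : Fin n) :
    ∑ i, gm L i h p * p.2 i = debar L h p := by
  have hD := hL.openD
  have e := debar_congr_on hD hp (fun q hq => hL.euler_de hq) h
  have hd (i : Fin n) := differentiableAt_of_contDiffOn hD (contDiffOn_de hD hL.smooth i) hp
  have hf (i : Fin n) := differentiableAt_of_contDiffOn hD (contDiffOn_fiber i) hp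
  rw [debar_sum _ fun i _ => (hd i).fun_mul (hf i)] at e
  simpa [debar_mul (hd _) (hf _), debar_fiber, hL.debar_de hp] using e

lemma sum_gm_conj_fiber (hL : IsCFM n D L) {p : Pt n} (hp : p ∈ D) (i : Fin n) :
    ∑ j, gm L i j p * (starRingEnd ℂ) (p.2 j) = de L i p := by
  have hD := hL.openD
  have e := de_congr_on hD hp (fun q hq => hL.euler_debar hq) i
  have hd (j : Fin n) := differentiableAt_of_contDiffOn hD (contDiffOn_debar hD hL.smooth j) hp
  have hf (j : Fin n) := differentiableAt_of_contDiffOn hD (contDiffOn_conj_fiber j) hp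
  rw [de_sum _ fun j _ => (hd j).fun_mul (hf j)] at e
  simp only [de_mul (hd _) (hf _), de_conj_fiber, mul_zero, add_zero] at e
  exact e

/-- The Cartan tensor annihilates the tautological direction. -/
lemma sum_de_gm_fiber (hL : IsCFM n D L) {p : Pt n} (hp : p ∈ D) (j k : Fin n) :
    ∑ i, de (gm L i j) k p * p.2 i = 0 := by
  have hD := hL.openD
  have e := de_congr_on hD hp (fun q hq => hL.sum_gm_fiber hq j) k
  have hd (i : Fin n) := differentiableAt_of_contDiffOn hD (hL.contDiffOn_gm i j) hp
  have hf (i : Fin n) := differentiableAt_of_contDiffOn hD (contDiffOn_fiber i) hp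
  rw [de_sum _ fun i _ => (hd i).fun_mul (hf i)] at e
  simpa [de_mul (hd _) (hf _), de_fiber, Finset.sum_add_distrib, ← gm.eq_1] using e

lemma sum_debar_gm_conj_fiber (hL : IsCFM n D L) {p : Pt n} (hp : p ∈ D) (i h : Fin n) :
    ∑ j, debar (gm L i j) h p * (starRingEnd ℂ) (p.2 j) = 0 := by
  have e := congrArg (starRingEnd ℂ) (hL.sum_de_gm_fiber hp i h)
  simpa [hL.debar_gm hp] using e

lemma sum_de_gm_conj_fiber (hL : IsCFM n D L) {p : Pt n} (hp : p ∈ D) (i k : Fin n) :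
    ∑ j, de (gm L i j) k p * (starRingEnd ℂ) (p.2 j) = de (de L i) k p := by
  have hD := hL.openD
  have e := de_congr_on hD hp (fun q hq => hL.sum_gm_conj_fiber hq i) k
  have hd (j : Fin n) := differentiableAt_of_contDiffOn hD (hL.contDiffOn_gm i j) hp
  have hf (j : Fin n) := differentiableAt_of_contDiffOn hD (contDiffOn_conj_fiber j) hp
  rw [de_sum _ fun j _ => (hd j).fun_mul (hf j)] at e
  simpa [de_mul (hd _) (hf _), de_conj_fiber] using e

lemma isUnit_det (hL : IsCFM n D L) {p : Pt n} (hp : p ∈ D) : IsUnit (gmat L p).det := by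
  rw [isUnit_iff_ne_zero]
  intro h0
  obtain ⟨v, hv, hv0⟩ := Matrix.exists_vecMul_eq_zero_iff.2 h0
  have := hL.posdef p hp v hv
  rw [Finset.sum_comm] at this
  have e (j : Fin n) : ∑ i, gm L i j p * v i * (starRingEnd ℂ) (v j) = 0 := by
    have := congrFun hv0 j
    simp only [Matrix.vecMul, dotProduct, gmat, Pi.zero_apply] at this
    rw [← Finset.sum_mul]
    simp only [mul_comm (gm L _ j p), this, zero_mul]
  simp [e] at this

lemma sum_gi_gm (hL : IsCFM n D L) {p : Pt n} (hp : p ∈ D) (l r : Fin n) :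
    ∑ i, gi L l i p * gm L i r p = if l = r then 1 else 0 := by
  have := congrFun (congrFun (Matrix.nonsing_inv_mul _ (hL.isUnit_det hp)) l) r
  rwa [Matrix.mul_apply, Matrix.one_apply] at this

/-- Lowering the upper index of the vertical coefficients gives `∂g_{j r̄}/∂η^k`. -/
lemma sum_gm_Cc (hL : IsCFM n D L) {p : Pt n} (hp : p ∈ D) (j r k : Fin n) :
    ∑ i, gm L i r p * Cc L i j k p = de (gm L j r) k p := by
  simp only [Cc, Finset.mul_sum]
  rw [Finset.sum_comm]
  have e (l : Fin n) : ∑ i, gm L i r p * (gi L l i p * de (gm L j l) k p) =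
      (if l = r then 1 else 0) * de (gm L j l) k p := by
    rw [← hL.sum_gi_gm hp, Finset.sum_mul]
    exact Finset.sum_congr rfl fun i _ => by ring
  simp [e]

lemma Cc_comm (hL : IsCFM n D L) {p : Pt n} (hp : p ∈ D) (i j k : Fin n) :
    Cc L i j k p = Cc L i k j p :=
  Finset.sum_congr rfl fun l _ => by rw [hL.de_gm_comm hp]

lemma sum_Cc_fiber (hL : IsCFM n D L) {p : Pt n} (hp : p ∈ D) (i k : Fin n) :
    ∑ j, Cc L i j k p * p.2 j = 0 := by
  simp only [Cc, Finset.sum_mul]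
  rw [Finset.sum_comm]
  refine Finset.sum_eq_zero fun l _ => ?_
  simp only [mul_assoc, ← Finset.mul_sum, hL.sum_de_gm_fiber hp, mul_zero]

lemma sum_de_Cc (hL : IsCFM n D L) {p : Pt n} (hp : p ∈ D) (j k : Fin n) :
    ∑ i, de L i p * Cc L i j k p = de (de L j) k p := by
  rw [← hL.sum_de_gm_conj_fiber hp]
  simp only [← hL.sum_gm_conj_fiber hp, Finset.sum_mul, ← hL.sum_gm_Cc hp]
  rw [Finset.sum_comm]
  exact Finset.sum_congr rfl fun i _ => Finset.sum_congr rfl fun l _ => by ring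

end IsCFM

end Metric

section DirBar

variable {f g : Pt n → ℂ} {d e : ℂ} {v : Fin n → ℂ} {p : Pt n} {D : Set (Pt n)}

/-- `f` is differentiable at `p` and `(∂f/∂η̄^s) v^s = d` there. -/
def HasDirBar (f : Pt n → ℂ) (d : ℂ) (v : Fin n → ℂ) (p : Pt n) : Prop :=
  DifferentiableAt ℝ f p ∧ ∑ s, debar f s p * v s = d

namespace HasDirBar

lemma unique (hf : HasDirBar f d v p) (hf' : HasDirBar f e v p) : d = e := hf.2.symm.trans hf'.2

lemma neg (hf : HasDirBar f d v p) : HasDirBar (fun q => -f q) (-d) v p :=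
  have e (s : Fin n) : debar (fun q => -f q) s p = -debar f s p := by
    simp only [debar, fderiv_fun_neg, neg_apply]; ring
  ⟨hf.1.fun_neg, by simp only [e, neg_mul, Finset.sum_neg_distrib, hf.2]⟩

lemma add (hf : HasDirBar f d v p) (hg : HasDirBar g e v p) :
    HasDirBar (fun q => f q + g q) (d + e) v p := by
  have h (s : Fin n) : debar (fun q => f q + g q) s p = debar f s p + debar g s p := by
    simp only [debar, fderiv_fun_add hf.1 hg.1, add_apply]; ring
  exact ⟨hf.1.fun_add hg.1, by simp only [h, add_mul, Finset.sum_add_distrib, hf.2, hg.2]⟩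

lemma mul (hf : HasDirBar f d v p) (hg : HasDirBar g e v p) :
    HasDirBar (fun q => f q * g q) (d * g p + f p * e) v p := by
  refine ⟨hf.1.fun_mul hg.1, ?_⟩
  simp only [debar_mul hf.1 hg.1, add_mul, Finset.sum_add_distrib, ← hf.2, ← hg.2,
    Finset.sum_mul, Finset.mul_sum]
  congr 1 <;> exact Finset.sum_congr rfl fun _ _ => by ring

lemma sum {ι : Type*} {t : Finset ι} {F : ι → Pt n → ℂ} {d : ι → ℂ}
    (hF : ∀ i ∈ t, HasDirBar (F i) (d i) v p) :
    HasDirBar (fun q => ∑ i ∈ t, F i q) (∑ i ∈ t, d i) v p := by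
  refine ⟨DifferentiableAt.fun_sum fun i hi => (hF i hi).1, ?_⟩
  simp only [debar_sum _ fun i hi => (hF i hi).1, Finset.sum_mul]
  rw [Finset.sum_comm]
  exact Finset.sum_congr rfl fun i hi => (hF i hi).2

lemma congr_on (hf : HasDirBar f d v p) (hD : IsOpen D) (hp : p ∈ D)
    (h : ∀ q ∈ D, g q = f q) : HasDirBar g d v p := by
  refine ⟨hf.1.congr_of_eventuallyEq (Filter.eventually_of_mem (hD.mem_nhds hp) h), ?_⟩
  simp only [debar_congr_on hD hp h, hf.2]

lemma div (hf : HasDirBar f d v p) (hg : HasDirBar g e v p) (h0 : g p ≠ 0) :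
    HasDirBar (fun q => f q / g q) ((d - f p / g p * e) / g p) v p := by
  have hq : DifferentiableAt ℝ (fun q => f q / g q) p := by
    simpa only [div_eq_mul_inv] using hf.1.fun_mul (hg.1.fun_inv h0)
  have h1 := HasDirBar.mul ⟨hq, rfl⟩ hg
  have hev : (fun q => f q / g q * g q) =ᶠ[nhds p] f := by
    filter_upwards [hg.1.continuousAt.eventually_ne h0] with q hq0
    exact div_mul_cancel₀ _ hq0
  have h2 : ∑ s, debar (fun q => f q / g q * g q) s p * v s = d := by
    rw [← hf.2]
    exact Finset.sum_congr rfl fun s _ => by rw [debar_eq_wirt, debar_eq_wirt, wirt_congr hev]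
  refine ⟨hq, ?_⟩
  rw [eq_div_iff h0]
  linear_combination h2 - h1.2

end HasDirBar

lemma hasDirBar_sqrt_re (hD : IsOpen D) (hp : p ∈ D) (him : ∀ q ∈ D, (f q).im = 0)
    (hpos : 0 < (f p).re) (hpos' : ∀ q ∈ D, 0 ≤ (f q).re) (hf : HasDirBar f d v p) :
    HasDirBar (fun q => (Real.sqrt (f q).re : ℂ)) (d / (2 * (Real.sqrt (f p).re : ℂ))) v p := by
  have hd : DifferentiableAt ℝ (fun q => (Real.sqrt (f q).re : ℂ)) p :=
    ofRealCLM.differentiableAt.comp p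
      ((reCLM.differentiableAt.comp p hf.1).sqrt hpos.ne')
  have h0 : (Real.sqrt (f p).re : ℂ) ≠ 0 := ofReal_ne_zero.2 (Real.sqrt_pos.2 hpos).ne'
  have h1 := HasDirBar.mul (v := v) ⟨hd, rfl⟩ ⟨hd, rfl⟩
  have h2 := hf.congr_on hD hp
    (g := fun q => (Real.sqrt (f q).re : ℂ) * (Real.sqrt (f q).re : ℂ)) fun q hq => by
      rw [← ofReal_mul, Real.mul_self_sqrt (hpos' q hq)]
      exact Complex.ext rfl (by simp [him q hq])
  refine ⟨hd, ?_⟩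
  rw [eq_div_iff (by simpa using h0)]
  linear_combination h1.unique h2

end DirBar

section Frame

variable {D : Set (Pt 2)} {L : Pt 2 → ℂ} {p : Pt 2}

namespace IsCFM

lemma det_gmat (L : Pt 2 → ℂ) (p : Pt 2) :
    (gmat L p).det = gm L 0 0 p * gm L 1 1 p - gm L 0 1 p * gm L 1 0 p := by
  rw [Matrix.det_fin_two]; rfl

lemma det_im (hL : IsCFM 2 D L) (hp : p ∈ D) : (gmat L p).det.im = 0 := by
  rw [← conj_eq_iff_im, det_gmat]
  simp only [map_sub, map_mul, hL.hermitian p hp]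
  ring

lemma det_re_pos (hL : IsCFM 2 D L) (hp : p ∈ D) : 0 < (gmat L p).det.re := by
  have h11 : 0 < (gm L 1 1 p).re := by
    simpa using hL.posdef p hp (Pi.single 1 1) (by simp)
  have him : (gm L 1 1 p).im = 0 := conj_eq_iff_im.1 (hL.hermitian p hp 1 1)
  have h := hL.posdef p hp ![gm L 1 1 p, -gm L 0 1 p] fun h0 => by
    have := congrFun h0 0
    simp only [Matrix.cons_val_zero, Pi.zero_apply] at this
    simp [this] at h11
  have e : ∑ i, ∑ j, gm L i j p * ![gm L 1 1 p, -gm L 0 1 p] i *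
      (starRingEnd ℂ) (![gm L 1 1 p, -gm L 0 1 p] j) = (gmat L p).det * gm L 1 1 p := by
    simp only [Fin.sum_univ_two, Matrix.cons_val_zero, Matrix.cons_val_one, det_gmat, map_neg,
      hL.hermitian p hp]
    ring
  rw [e, mul_re, him, mul_zero, sub_zero] at h
  exact pos_of_mul_pos_left h h11.le

lemma Fh_mul_self (hL : IsCFM 2 D L) (hp : p ∈ D) : Fh L p * Fh L p = L p := by
  rw [Fh, ← ofReal_mul, Real.mul_self_sqrt (hL.pos p hp).le]
  exact Complex.ext rfl (by simp [hL.real_im p hp])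

lemma Fh_ne_zero (hL : IsCFM 2 D L) (hp : p ∈ D) : Fh L p ≠ 0 :=
  ofReal_ne_zero.2 (Real.sqrt_pos.2 (hL.pos p hp)).ne'

lemma sg_mul_self (hL : IsCFM 2 D L) (hp : p ∈ D) : sg L p * sg L p = (gmat L p).det := by
  rw [sg, ← ofReal_mul, Real.mul_self_sqrt (hL.det_re_pos hp).le]
  exact Complex.ext rfl (by simp [hL.det_im hp])

lemma sg_ne_zero (hL : IsCFM 2 D L) (hp : p ∈ D) : sg L p ≠ 0 :=
  ofReal_ne_zero.2 (Real.sqrt_pos.2 (hL.det_re_pos hp)).ne'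

lemma llow_eq (hL : IsCFM 2 D L) (hp : p ∈ D) (i : Fin 2) : llow L i p = de L i p / Fh L p := by
  rw [llow, hL.sum_gm_conj_fiber hp]

lemma conj_de (hL : IsCFM 2 D L) (hp : p ∈ D) (i : Fin 2) :
    (starRingEnd ℂ) (de L i p) = debar L i p := by
  rw [← hL.sum_gm_conj_fiber hp, ← hL.sum_gm_fiber hp]
  simp [hL.hermitian p hp]

lemma mup_zero (hL : IsCFM 2 D L) (hp : p ∈ D) :
    mup L 0 p = -(de L 1 p / Fh L p) / sg L p := by
  simp [mup, hL.llow_eq hp]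

lemma mup_one (hL : IsCFM 2 D L) (hp : p ∈ D) :
    mup L 1 p = de L 0 p / Fh L p / sg L p := by
  simp [mup, hL.llow_eq hp]

lemma mlow_eq (hL : IsCFM 2 D L) (hp : p ∈ D) :
    mlow L 0 p = -(sg L p * p.2 1 / Fh L p) ∧ mlow L 1 p = sg L p * p.2 0 / Fh L p := by
  have hF := hL.Fh_ne_zero hp
  have hs := hL.sg_ne_zero hp
  have hF' : (starRingEnd ℂ) (Fh L p) = Fh L p := conj_ofReal _
  have hs' : (starRingEnd ℂ) (sg L p) = sg L p := conj_ofReal _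
  have hsq := hL.sg_mul_self hp
  have h0 := hL.sum_gm_fiber hp 0
  have h1 := hL.sum_gm_fiber hp 1
  rw [det_gmat] at hsq
  rw [Fin.sum_univ_two] at h0 h1
  constructor
  all_goals
    rw [mlow, Fin.sum_univ_two, hL.mup_zero hp, hL.mup_one hp]
    simp only [map_neg, map_div₀, hL.conj_de hp, hF', hs', ← h0, ← h1]
    field_simp
  · linear_combination p.2 1 * hsq
  · linear_combination -p.2 0 * hsq

/-- A covector annihilating the tautological direction is a multiple of `m_i`. -/
lemma eq_contract_mul_mlow (hL : IsCFM 2 D L) (hp : p ∈ D) {T : Fin 2 → ℂ}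
    (hT : ∑ i, T i * p.2 i = 0) (j : Fin 2) : T j = (∑ i, T i * mup L i p) * mlow L j p := by
  have hF := hL.Fh_ne_zero hp
  have hs := hL.sg_ne_zero hp
  have hE := hL.euler_de hp
  rw [← hL.Fh_mul_self hp] at hE
  rw [Fin.sum_univ_two] at hT hE ⊢
  rw [hL.mup_zero hp, hL.mup_one hp]
  fin_cases j
  · simp only [Fin.zero_eta, (hL.mlow_eq hp).1]
    field_simp
    linear_combination -T 0 * hE + de L 0 p * hT
  · simp only [Fin.mk_one, (hL.mlow_eq hp).2]
    field_simp
    linear_combination -T 1 * hE + de L 1 p * hT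

lemma eq_contract_mul_conj_mlow (hL : IsCFM 2 D L) (hp : p ∈ D) {T : Fin 2 → ℂ}
    (hT : ∑ i, T i * (starRingEnd ℂ) (p.2 i) = 0) (j : Fin 2) :
    T j = (∑ i, T i * (starRingEnd ℂ) (mup L i p)) * (starRingEnd ℂ) (mlow L j p) := by
  have h := hL.eq_contract_mul_mlow hp (T := fun i => (starRingEnd ℂ) (T i))
    (by simpa using congrArg (starRingEnd ℂ) hT) j
  simpa using congrArg (starRingEnd ℂ) h

lemma sum_de_mup (hL : IsCFM 2 D L) (hp : p ∈ D) : ∑ i, de L i p * mup L i p = 0 := by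
  rw [Fin.sum_univ_two, hL.mup_zero hp, hL.mup_one hp]
  ring

lemma sB_eq (hL : IsCFM 2 D L) (hp : p ∈ D) :
    sB L p = ∑ j, ∑ k, ∑ l, (starRingEnd ℂ) (mup L l p) * mup L k p * mup L j p *
      de (gm L j l) k p := by
  simp only [sB, mlow, ← hL.sum_gm_Cc hp, Fin.sum_univ_two]
  ring

lemma conj_sB (hL : IsCFM 2 D L) (hp : p ∈ D) :
    (starRingEnd ℂ) (sB L p) = ∑ l, mup L l p * ∑ j, (∑ k, debar (gm L l j) k p *
      (starRingEnd ℂ) (mup L k p)) * (starRingEnd ℂ) (mup L j p) := by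
  simp only [hL.sB_eq hp, Fin.sum_univ_two, map_add, map_mul, conj_conj, hL.debar_gm hp]
  ring

lemma hasDirBar_gm (hL : IsCFM 2 D L) (hp : p ∈ D) (i j : Fin 2) (v : Fin 2 → ℂ) :
    HasDirBar (gm L i j) (∑ k, debar (gm L i j) k p * v k) v p :=
  ⟨differentiableAt_of_contDiffOn hL.openD (hL.contDiffOn_gm i j) hp, rfl⟩

lemma hasDirBar_det (hL : IsCFM 2 D L) (hp : p ∈ D) :
    HasDirBar (fun q => (gmat L q).det) ((gmat L p).det * (starRingEnd ℂ) (sB L p))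
      (fun s => (starRingEnd ℂ) (mup L s p)) p := by
  set w : Fin 2 → ℂ := fun s => (starRingEnd ℂ) (mup L s p)
  have h := fun i j => hL.hasDirBar_gm hp i j w
  have h1 := (((h 0 0).mul (h 1 1)).add ((h 0 1).mul (h 1 0)).neg).congr_on hL.openD hp
    (g := fun q => (gmat L q).det) fun q _ => by rw [det_gmat, sub_eq_add_neg]
  have hE (l j : Fin 2) := hL.eq_contract_mul_conj_mlow hp
    (T := fun j => ∑ k, debar (gm L l j) k p * w k) (by
      simp only [Finset.sum_mul]
      rw [Finset.sum_comm]
      refine Finset.sum_eq_zero fun k _ => ?_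
      have := hL.sum_debar_gm_conj_fiber hp l k
      simp only [mul_right_comm _ (w k), ← Finset.sum_mul, this, zero_mul]) j
  have hB := hL.conj_sB hp
  have hF := hL.Fh_ne_zero hp
  have hs := hL.sg_ne_zero hp
  have hF' : (starRingEnd ℂ) (Fh L p) = Fh L p := conj_ofReal _
  have hs' : (starRingEnd ℂ) (sg L p) = sg L p := conj_ofReal _
  refine ⟨h1.1, h1.2.trans ?_⟩
  rw [hB]
  simp only [hE 0 0, hE 0 1, hE 1 0, hE 1 1]
  rw [Fin.sum_univ_two (f := fun l => mup L l p * _)]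
  generalize (∑ j, (∑ k, debar (gm L 0 j) k p * w k) * (starRingEnd ℂ) (mup L j p)) = E0
  generalize (∑ j, (∑ k, debar (gm L 1 j) k p * w k) * (starRingEnd ℂ) (mup L j p)) = E1
  have d0 := hL.sum_gm_conj_fiber hp 0
  have d1 := hL.sum_gm_conj_fiber hp 1
  rw [Fin.sum_univ_two] at d0 d1
  rw [(hL.mlow_eq hp).1, (hL.mlow_eq hp).2, hL.mup_zero hp, hL.mup_one hp, ← hL.sg_mul_self hp,
    ← d0, ← d1]
  simp only [map_neg, map_div₀, map_mul, hF', hs']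
  field_simp
  ring

lemma hasDirBar_sg (hL : IsCFM 2 D L) (hp : p ∈ D) :
    HasDirBar (sg L) (sg L p * (starRingEnd ℂ) (sB L p) / 2)
      (fun s => (starRingEnd ℂ) (mup L s p)) p := by
  have h := hasDirBar_sqrt_re hL.openD hp (fun q hq => hL.det_im hq) (hL.det_re_pos hp)
    (fun q hq => (hL.det_re_pos hq).le) (hL.hasDirBar_det hp)
  refine ⟨h.1, h.2.trans ?_⟩
  change _ / (2 * sg L p) = _
  rw [← hL.sg_mul_self hp]
  field_simp [hL.sg_ne_zero hp]

lemma hasDirBar_Fh (hL : IsCFM 2 D L) (hp : p ∈ D) :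
    HasDirBar (Fh L) 0 (fun s => (starRingEnd ℂ) (mup L s p)) p := by
  have h0 : HasDirBar L 0 (fun s => (starRingEnd ℂ) (mup L s p)) p :=
    ⟨differentiableAt_of_contDiffOn hL.openD hL.smooth hp, by
      simpa [hL.conj_de hp] using congrArg (starRingEnd ℂ) (hL.sum_de_mup hp)⟩
  have h := hasDirBar_sqrt_re hL.openD hp hL.real_im (hL.pos p hp)
    (fun q hq => (hL.pos q hq).le) h0
  exact ⟨h.1, h.2.trans (zero_div _)⟩

lemma hasDirBar_llow (hL : IsCFM 2 D L) (hp : p ∈ D) (i : Fin 2) :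
    HasDirBar (llow L i) (mlow L i p / Fh L p) (fun s => (starRingEnd ℂ) (mup L s p)) p := by
  have h1 : HasDirBar (de L i) (mlow L i p) (fun s => (starRingEnd ℂ) (mup L s p)) p :=
    ⟨differentiableAt_of_contDiffOn hL.openD (contDiffOn_de hL.openD hL.smooth i) hp, by
      simp only [hL.debar_de hp, mlow]⟩
  have h := (h1.div (hL.hasDirBar_Fh hp) (hL.Fh_ne_zero hp)).congr_on hL.openD hp
    fun q hq => hL.llow_eq hq i
  exact ⟨h.1, h.2.trans (by simp)⟩

lemma hasDirBar_mlow (hL : IsCFM 2 D L) (hp : p ∈ D) (i : Fin 2) :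
    HasDirBar (mlow L i) (mlow L i p * (starRingEnd ℂ) (sB L p) / 2)
      (fun s => (starRingEnd ℂ) (mup L s p)) p := by
  have hη (j : Fin 2) :
      HasDirBar (fun q : Pt 2 => q.2 j) 0 (fun s => (starRingEnd ℂ) (mup L s p)) p :=
    ⟨(hasFDerivAt_fiber j p).differentiableAt, by simp [debar_fiber]⟩
  have h (j : Fin 2) := ((hL.hasDirBar_sg hp).mul (hη j)).div (hL.hasDirBar_Fh hp)
    (hL.Fh_ne_zero hp)
  fin_cases i
  · have h1 := (h 1).neg.congr_on hL.openD hp fun q hq => (hL.mlow_eq hq).1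
    exact ⟨h1.1, h1.2.trans (by simp only [Fin.zero_eta, (hL.mlow_eq hp).1]; ring)⟩
  · have h1 := (h 0).congr_on hL.openD hp fun q hq => (hL.mlow_eq hq).2
    exact ⟨h1.1, h1.2.trans (by simp only [Fin.mk_one, (hL.mlow_eq hp).2]; ring)⟩

lemma hasDirBar_mup (hL : IsCFM 2 D L) (hp : p ∈ D) (i : Fin 2) :
    HasDirBar (mup L i)
      (-(p.2 i / (Fh L p * Fh L p)) - mup L i p * (starRingEnd ℂ) (sB L p) / 2)
      (fun s => (starRingEnd ℂ) (mup L s p)) p := by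
  have hs := hL.sg_ne_zero hp
  have hF := hL.Fh_ne_zero hp
  fin_cases i
  · have h1 := ((hL.hasDirBar_llow hp 1).neg.div (hL.hasDirBar_sg hp) hs).congr_on hL.openD hp
      (g := mup L 0) fun q _ => by simp [mup]
    refine ⟨h1.1, h1.2.trans ?_⟩
    simp only [Fin.zero_eta, (hL.mlow_eq hp).2, mup, if_true]
    field_simp
  · have h1 := ((hL.hasDirBar_llow hp 0).div (hL.hasDirBar_sg hp) hs).congr_on hL.openD hp
      (g := mup L 1) fun q _ => by simp [mup]
    refine ⟨h1.1, h1.2.trans ?_⟩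
    simp only [Fin.mk_one, (hL.mlow_eq hp).1, mup, one_ne_zero, if_false]
    field_simp

lemma differentiableAt_Cc (hL : IsCFM 2 D L) (hp : p ∈ D) (i j k : Fin 2) :
    DifferentiableAt ℝ (Cc L i j k) p := by
  have hg (a b : Fin 2) : DifferentiableAt ℝ (fun q => gm L a b q) p :=
    differentiableAt_of_contDiffOn hL.openD (hL.contDiffOn_gm a b) hp
  have hdet : DifferentiableAt ℝ (fun q => ((gmat L q).det)⁻¹) p :=
    (hL.hasDirBar_det hp).1.fun_inv (hL.isUnit_det hp).ne_zero
  have hgi (l : Fin 2) : DifferentiableAt ℝ (gi L l i) p := by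
    have e : gi L l i = fun q => ((gmat L q).det)⁻¹ *
        !![gm L 1 1 q, -gm L 0 1 q; -gm L 1 0 q, gm L 0 0 q] l i := by
      funext q
      rw [gi, Matrix.inv_def, Matrix.adjugate_fin_two, Matrix.smul_apply, Ring.inverse_eq_inv',
        smul_eq_mul]
      rfl
    rw [e]
    refine hdet.fun_mul ?_
    fin_cases l <;> fin_cases i
    exacts [hg 1 1, (hg 0 1).fun_neg, (hg 1 0).fun_neg, hg 0 0]
  exact DifferentiableAt.fun_sum fun l _ => (hgi l).fun_mul
    (differentiableAt_of_contDiffOn hL.openD (contDiffOn_de hL.openD (hL.contDiffOn_gm j l) k) hp)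

lemma sum_gm_debar_Cc (hL : IsCFM 2 D L) (hp : p ∈ D) (r j h k : Fin 2) :
    ∑ i, (debar (gm L i r) h p * Cc L i j k p + gm L i r p * debar (Cc L i j k) h p) =
      debar (de (gm L j r) k) h p := by
  have hg (i : Fin 2) := differentiableAt_of_contDiffOn hL.openD (hL.contDiffOn_gm i r) hp
  have hC (i : Fin 2) := hL.differentiableAt_Cc hp i j k
  rw [← debar_congr_on hL.openD hp (fun q hq => hL.sum_gm_Cc hq j r k) h,
    debar_sum _ fun i _ => (hg i).fun_mul (hC i)]
  simp only [debar_mul (hg _) (hC _)]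

lemma Sv_comm_bar (hL : IsCFM 2 D L) (hp : p ∈ D) (r j h k : Fin 2) :
    Sv L r j h k p = Sv L h j r k p := by
  have e1 := hL.sum_gm_debar_Cc hp r j h k
  have e2 := hL.sum_gm_debar_Cc hp h j r k
  have e3 : debar (de (gm L j r) k) h p = debar (de (gm L j h) k) r p := by
    rw [debar_de_comm hL.openD (hL.contDiffOn_gm j r) hp,
      debar_de_comm hL.openD (hL.contDiffOn_gm j h) hp]
    exact de_congr_on hL.openD hp (fun q hq => hL.debar_gm_comm hq j r h) k
  simp only [Finset.sum_add_distrib, hL.debar_gm_comm hp _ r h] at e1 e2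
  simp only [Sv]
  linear_combination e2 - e1 - e3

lemma sum_de_debar_Cc (hL : IsCFM 2 D L) (hp : p ∈ D) (j h k : Fin 2) :
    ∑ i, de L i p * debar (Cc L i j k) h p = 0 := by
  have hd (i : Fin 2) := differentiableAt_of_contDiffOn hL.openD
    (contDiffOn_de hL.openD hL.smooth i) hp
  have hC (i : Fin 2) := hL.differentiableAt_Cc hp i j k
  have e := debar_congr_on hL.openD hp (fun q hq => hL.sum_de_Cc hq j k) h
  rw [debar_sum _ fun i _ => (hd i).fun_mul (hC i)] at e
  change _ = debar (de (de L j) k) h p at e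
  rw [debar_de_comm hL.openD (contDiffOn_de hL.openD hL.smooth j) hp,
    de_congr_on hL.openD hp (fun q hq => hL.debar_de hq j h)] at e
  simp only [debar_mul (hd _) (hC _), hL.debar_de hp, Finset.sum_add_distrib] at e
  have e' := hL.sum_gm_Cc hp j h k
  change _ = de (fun q => gm L j h q) k p at e'
  linear_combination e - e'

lemma sum_debar_Cc_fiber (hL : IsCFM 2 D L) (hp : p ∈ D) (i h k : Fin 2) :
    ∑ j, debar (Cc L i j k) h p * p.2 j = 0 := by
  have hη (j : Fin 2) := (hasFDerivAt_fiber j p).differentiableAt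
  have hC (j : Fin 2) := hL.differentiableAt_Cc hp i j k
  have e := debar_congr_on hL.openD hp (g := fun _ => 0) (fun q hq => hL.sum_Cc_fiber hq i k) h
  rw [debar_sum _ fun j _ => (hC j).fun_mul (hη j)] at e
  have h0 : debar (fun _ : Pt 2 => (0 : ℂ)) h p = 0 := by simp [debar]
  simpa [debar_mul (hC _) (hη _), debar_fiber, h0] using e

lemma sum_Sv_fiber (hL : IsCFM 2 D L) (hp : p ∈ D) (r h k : Fin 2) :
    ∑ j, Sv L r j h k p * p.2 j = 0 := by
  simp only [Sv, neg_mul, Finset.sum_mul, Finset.sum_neg_distrib, mul_assoc]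
  rw [Finset.sum_comm]
  simp only [← Finset.mul_sum, hL.sum_debar_Cc_fiber hp, mul_zero, Finset.sum_const_zero, neg_zero]

lemma Sv_comm (hL : IsCFM 2 D L) (hp : p ∈ D) (r j h k : Fin 2) :
    Sv L r j h k p = Sv L r k h j p := by
  simp only [Sv, debar_congr_on hL.openD hp (fun q hq => hL.Cc_comm hq _ j k)]

lemma sum_Sv_conj_fiber (hL : IsCFM 2 D L) (hp : p ∈ D) (j h k : Fin 2) :
    ∑ r, Sv L r j h k p * (starRingEnd ℂ) (p.2 r) = 0 := by
  simp only [Sv, neg_mul, Finset.sum_mul, Finset.sum_neg_distrib]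
  rw [Finset.sum_comm]
  simp only [mul_right_comm _ _ ((starRingEnd ℂ) _), ← Finset.sum_mul, hL.sum_gm_conj_fiber hp,
    hL.sum_de_debar_Cc hp, neg_zero]

lemma Sv_eq_contract (hL : IsCFM 2 D L) (hp : p ∈ D) (r j h k : Fin 2) :
    Sv L r j h k p = (-∑ i, ∑ j, ∑ k, mlow L i p * mup L j p * mup L k p *
        ∑ s, debar (Cc L i j k) s p * (starRingEnd ℂ) (mup L s p)) *
      (starRingEnd ℂ) (mlow L h p) * (starRingEnd ℂ) (mlow L r p) * mlow L j p * mlow L k p := by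
  have e1 := hL.eq_contract_mul_conj_mlow hp
    (T := fun r => Sv L r j h k p) (hL.sum_Sv_conj_fiber hp j h k) r
  have e2 (r) := hL.eq_contract_mul_conj_mlow hp
    (T := fun h => Sv L r j h k p)
    (by simpa only [hL.Sv_comm_bar hp r] using hL.sum_Sv_conj_fiber hp j r k) h
  have e3 (r h) := hL.eq_contract_mul_mlow hp
    (T := fun j => Sv L r j h k p) (hL.sum_Sv_fiber hp r h k) j
  have e4 (r j h) := hL.eq_contract_mul_mlow hp
    (T := fun k => Sv L r j h k p)
    (by simpa only [hL.Sv_comm hp r j] using hL.sum_Sv_fiber hp r h j) k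
  have hσ : (-∑ i, ∑ j, ∑ k, mlow L i p * mup L j p * mup L k p *
        ∑ s, debar (Cc L i j k) s p * (starRingEnd ℂ) (mup L s p)) =
      ∑ r, (∑ h, (∑ j, (∑ k, Sv L r j h k p * mup L k p) * mup L j p) *
        (starRingEnd ℂ) (mup L h p)) * (starRingEnd ℂ) (mup L r p) := by
    simp only [Sv, mlow, Fin.sum_univ_two]
    ring
  have f3 (r h) : Sv L r j h k p = (∑ j, (∑ k, Sv L r j h k p * mup L k p) * mup L j p) *
      mlow L j p * mlow L k p := by
    rw [e3 r h, Fin.sum_univ_two, e4 r 0 h, e4 r 1 h,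
      Fin.sum_univ_two (f := fun j => (∑ k, Sv L r j h k p * mup L k p) * mup L j p)]
    ring
  rw [hσ, e1, Fin.sum_univ_two, e2 0, e2 1, Fin.sum_univ_two, Fin.sum_univ_two,
    f3 0 0, f3 0 1, f3 1 0, f3 1 1]
  simp only [Fin.sum_univ_two]
  ring

lemma hasDirBar_sB (hL : IsCFM 2 D L) (hp : p ∈ D) :
    HasDirBar (sB L) (∑ i, ∑ j, ∑ k, mlow L i p * mup L j p * mup L k p *
        ∑ s, debar (Cc L i j k) s p * (starRingEnd ℂ) (mup L s p) -
        sB L p * (starRingEnd ℂ) (sB L p) / 2)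
      (fun s => (starRingEnd ℂ) (mup L s p)) p := by
  have hm := hL.hasDirBar_mup hp
  have hl := hL.hasDirBar_mlow hp
  have hC (i j k) : HasDirBar (Cc L i j k) _ (fun s => (starRingEnd ℂ) (mup L s p)) p :=
    ⟨hL.differentiableAt_Cc hp i j k, rfl⟩
  have h : HasDirBar (sB L) _ _ p := HasDirBar.sum fun j _ => HasDirBar.sum fun k _ =>
    HasDirBar.sum fun i _ => (((hl i).mul (hm k)).mul (hm j)).mul (hC i j k)
  refine ⟨h.1, h.2.trans ?_⟩
  have c0 (i k) := hL.sum_Cc_fiber hp i k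
  have c1 (i k) : ∑ j, Cc L i k j p * p.2 j = 0 := by simpa only [hL.Cc_comm hp i k] using c0 i k
  generalize hβ : (starRingEnd ℂ) (sB L p) = β
  simp only [sB, Fin.sum_univ_two] at c0 c1 ⊢
  linear_combination
    -(mup L 0 p / (Fh L p * Fh L p)) *
      (mlow L 0 p * (c0 0 0 + c1 0 0) + mlow L 1 p * (c0 1 0 + c1 1 0))
    - (mup L 1 p / (Fh L p * Fh L p)) *
      (mlow L 0 p * (c0 0 1 + c1 0 1) + mlow L 1 p * (c0 1 1 + c1 1 1))

lemma hasDirBar_sA (hL : IsCFM 2 D L) (hp : p ∈ D) :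
    HasDirBar (sA L) (-(sA L p) * (starRingEnd ℂ) (sB L p) + sB L p / Fh L p)
      (fun s => (starRingEnd ℂ) (mup L s p)) p := by
  have hm := hL.hasDirBar_mup hp
  have hl := hL.hasDirBar_llow hp
  have hC (i j k) : HasDirBar (Cc L i j k) _ (fun s => (starRingEnd ℂ) (mup L s p)) p :=
    ⟨hL.differentiableAt_Cc hp i j k, rfl⟩
  have h : HasDirBar (sA L) _ _ p := HasDirBar.sum fun j _ => HasDirBar.sum fun k _ =>
    HasDirBar.sum fun i _ => (((hm j).mul (hm k)).mul (hl i)).mul (hC i k j)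
  refine ⟨h.1, h.2.trans ?_⟩
  have c0 (i k) := hL.sum_Cc_fiber hp i k
  have c1 (i k) : ∑ j, Cc L i k j p * p.2 j = 0 := by simpa only [hL.Cc_comm hp i k] using c0 i k
  have d (j k) :
      ∑ i, llow L i p * ∑ s, debar (Cc L i j k) s p * (starRingEnd ℂ) (mup L s p) = 0 := by
    simp only [hL.llow_eq hp, Finset.mul_sum]
    rw [Finset.sum_comm]
    refine Finset.sum_eq_zero fun s _ => ?_
    have := hL.sum_de_debar_Cc hp j s k
    rw [Fin.sum_univ_two] at this ⊢
    linear_combination ((starRingEnd ℂ) (mup L s p) / Fh L p) * this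
  generalize hβ : (starRingEnd ℂ) (sB L p) = β
  beta_reduce
  generalize (fun i j k => ∑ s, debar (Cc L i j k) s p * (starRingEnd ℂ) (mup L s p)) = dC at d ⊢
  simp only [sA, sB, Fin.sum_univ_two] at c0 c1 d ⊢
  linear_combination
    -(mup L 0 p / (Fh L p * Fh L p)) *
      (llow L 0 p * (c0 0 0 + c1 0 0) + llow L 1 p * (c0 1 0 + c1 1 0))
    - (mup L 1 p / (Fh L p * Fh L p)) *
      (llow L 0 p * (c0 0 1 + c1 0 1) + llow L 1 p * (c0 1 1 + c1 1 1))
    + mup L 0 p * (mup L 0 p * d 0 0 + mup L 1 p * d 0 1)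
    + mup L 1 p * (mup L 0 p * d 1 0 + mup L 1 p * d 1 1)

end IsCFM

end Frame

/-- `S_{r̄ j h̄ k} = I m_h̄ m_r̄ m_j m_k` and `(∂A/∂η̄^s) m̄^s = −A B̄ + B/F`. -/
theorem statement2 (D : Set (Pt 2)) (L : Pt 2 → ℂ) (hL : IsCFM 2 D L) :
    ∀ p ∈ D,
      (∀ r j h k : Fin 2, Sv L r j h k p =
        vI L p * (starRingEnd ℂ) (mlow L h p) * (starRingEnd ℂ) (mlow L r p) *
          mlow L j p * mlow L k p) ∧
      (∑ s, debar (sA L) s p * (starRingEnd ℂ) (mup L s p)) =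
        -(sA L p) * (starRingEnd ℂ) (sB L p) + sB L p / Fh L p := by
  intro p hp
  have hI : vI L p = -∑ i, ∑ j, ∑ k, mlow L i p * mup L j p * mup L k p *
      ∑ s, debar (Cc L i j k) s p * (starRingEnd ℂ) (mup L s p) := by
    rw [vI, (hL.hasDirBar_sB hp).2]
    ring
  exact ⟨fun r j h k => by rw [hI, hL.Sv_eq_contract hp], (hL.hasDirBar_sA hp).2⟩

end CFinsler
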